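/- Let A and B be finite groups, C a group, and f : C →* A, g : C →* B injective homomorphisms. Then the amalgamated free product A *_C B (the pushout of f and g in the category of groups) is virtually free: it has a subgroup of finite index which is a free group. -/

import Mathlib

open CategoryTheory CategoryTheory.ActionCategory

theorem CategoryTheory.ActionCategory.map_eq_curry_left {G Ω X : Type*} [Group G] [MulAction G Ω]
    [Group X] (E : ActionCategory G Ω ⥤ SingleObj X) {a b : ActionCategory G Ω} (m : a ⟶ b) :
    E.map m = (curry E m.val).left b.back := by
  revert a b m
  apply ActionCategory.cases
  intros
  rfl

/-- If cocycles on an action groupoid with values in a group, encoded as sections of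
`(Ω → X) ⋊ G → G`, are freely determined by their values on a family of arrows
`e i : s i ⟶ t i`, then the action groupoid is free on these arrows. -/
@[reducible]
noncomputable def IsFreeGroupoid.ofUniqueCocycle {G Ω ι : Type} [Group G] [MulAction G Ω]
    (s t : ι → Ω) (e : ι → G) (he : ∀ i, e i • s i = t i)
    (h : ∀ (X : Type) [Group X] (l : ι → X), ∃! φ : G →* (Ω → X) ⋊[mulAutArrow] G,
      (∀ p, (φ p).right = p) ∧ ∀ i, (φ (e i)).left (t i) = l i) :
    IsFreeGroupoid (ActionCategory G Ω) where
  quiverGenerators := ⟨fun a b => {i : ι // s i = a.back ∧ t i = b.back}⟩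
  of := fun (i : Subtype _) => ⟨e i.1, by
    have := he i.1
    rw [i.2.1, i.2.2] at this
    exact this⟩
  unique_lift := by
    intro X _ l
    obtain ⟨φ, ⟨hφ, hl⟩, hu⟩ := h X fun i => @l ⟨(), s i⟩ ⟨(), t i⟩ ⟨i, rfl, rfl⟩
    refine ⟨uncurry φ hφ, ?_, ?_⟩
    · rintro ⟨⟨⟩, a : Ω⟩ ⟨⟨⟩, b : Ω⟩ ⟨i, h₁ : s i = a, h₂ : t i = b⟩
      subst h₁ h₂
      exact hl i
    · intro E hE
      have key : curry E = φ :=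
        hu _ ⟨fun p => rfl, fun i => (map_eq_curry_left E _).symm.trans
          (hE ⟨(), s i⟩ ⟨(), t i⟩ ⟨i, rfl, rfl⟩)⟩
      refine Functor.hext (fun _ => rfl) fun a b m => heq_of_eq ?_
      refine (map_eq_curry_left E m).trans ?_
      rw [key]
      rfl

theorem isFreeGroup_of_equiv_hom {D H : Type} [Groupoid.{0} D] [IsConnected D]
    [IsFreeGroupoid D] [Group H] (r : D) (e : (r ⟶ r) ≃ H)
    (he : ∀ m n : r ⟶ r, e (m ≫ n) = e n * e m) : IsFreeGroup H :=
  IsFreeGroup.ofMulEquiv (G := End r) { e with map_mul' := fun m n => he n m }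

theorem isFreeGroup_stabilizer {G Ω : Type} [Group G] [MulAction G Ω]
    [MulAction.IsPretransitive G Ω] (x : Ω) (hfree : IsFreeGroupoid (ActionCategory G Ω)) :
    IsFreeGroup (MulAction.stabilizer G x) := by
  have : Nonempty Ω := ⟨x⟩
  have hconn : IsConnected (ActionCategory G Ω) := inferInstance
  exact @isFreeGroup_of_equiv_hom _ _ _ hconn hfree _ (x : ActionCategory G Ω)
    { toFun := fun m => ⟨m.val, m.property⟩
      invFun := fun m => ⟨m.val, m.property⟩
      left_inv := fun _ => rfl
      right_inv := fun _ => rfl } fun _ _ => rfl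

section Cocycle

variable {G Ω X : Type} [Group G] [MulAction G Ω] [Group X]

theorem cocycle_mul {φ : G →* (Ω → X) ⋊[mulAutArrow] G} (hφ : ∀ p, (φ p).right = p)
    (p q : G) (y : Ω) : (φ (p * q)).left y = (φ p).left y * (φ q).left (p⁻¹ • y) := by
  rw [map_mul, SemidirectProduct.mul_left, hφ]
  rfl

theorem cocycle_one (φ : G →* (Ω → X) ⋊[mulAutArrow] G) (y : Ω) : (φ 1).left y = 1 := by
  rw [map_one]
  rfl

/-- The coboundary of `u`, restricted along a homomorphism into the acting group. -/
def coboundary {K : Type} [Group K] (j : K →* G) (u : Ω → X) :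
    K →* (Ω → X) ⋊[mulAutArrow] G where
  toFun k := ⟨fun y => u y * (u ((j k)⁻¹ • y))⁻¹, j k⟩
  map_one' := by
    ext y
    · simp
    · simp
  map_mul' k l := by
    ext y
    · change _ = u y * (u ((j k)⁻¹ • y))⁻¹ *
        (u ((j k)⁻¹ • y) * (u ((j l)⁻¹ • (j k)⁻¹ • y))⁻¹)
      simp [mul_smul]
    · simp

/-- A cocycle whose restriction to a group acting freely agrees with `u` along arrows from a
choice of base points of the orbits restricts to the coboundary of `u`. -/
theorem cocycle_eq_coboundary {K : Type} [Group K] (j : K →* G)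
    (hj : ∀ k (x : Ω), j k • x = x → k = 1)
    {φ : G →* (Ω → X) ⋊[mulAutArrow] G} (hφ : ∀ p, (φ p).right = p)
    {u : Ω → X} {r : Ω → Ω} (hr : ∀ k x, r (j k • x) = r x) {κ : Ω → K}
    (hκ : ∀ x, j (κ x) • r x = x) (hu : ∀ x, (φ (j (κ x))).left x = u x) :
    φ.comp j = coboundary j u := by
  ext k y
  · change (φ (j k)).left y = u y * (u ((j k)⁻¹ • y))⁻¹
    obtain ⟨x, rfl⟩ : ∃ x, y = j k • x := ⟨(j k)⁻¹ • y, by simp⟩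
    have h1 : κ (j k • x) = k * κ x := by
      have h2 := hκ (j k • x)
      rw [hr] at h2
      have : (κ x)⁻¹ * k⁻¹ * κ (j k • x) = 1 := by
        apply hj _ (r x)
        rw [map_mul, map_mul, mul_smul, h2, mul_smul, map_inv, map_inv, inv_smul_smul,
          inv_smul_eq_iff, hκ]
      rw [mul_assoc, inv_mul_eq_one, eq_comm, inv_mul_eq_iff_eq_mul] at this
      exact this
    rw [inv_smul_smul, ← hu, ← hu, h1, map_mul j, cocycle_mul hφ, inv_smul_smul,
      mul_inv_cancel_right]
  · exact hφ _

/-- A choice of base points for the orbits of a group acting through `j`. -/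
theorem exists_orbit_section {K : Type} [Group K] (j : K →* G) (Ω : Type) [MulAction G Ω] :
    ∃ r : Ω → Ω, (∀ k x, r (j k • x) = r x) ∧ ∀ x, ∃ k, j k • r x = x := by
  let := MulAction.compHom Ω j
  refine ⟨fun x => (Quotient.mk (MulAction.orbitRel K Ω) x).out, fun k x => ?_, fun x => ?_⟩
  · exact congrArg Quotient.out (Quotient.sound ⟨k, rfl⟩)
  · exact (MulAction.orbitRel K Ω).symm (Quotient.mk_out x)

end Cocycle

/-- If both factors of an amalgam act freely, then the action groupoid is free. -/
theorem amalgam_nonempty_isFreeGroupoid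
    {A B C P Ω : Type} [Group A] [Group B] [Group C] [Group P] [MulAction P Ω]
    (f : C →* A) (g : C →* B) (jA : A →* P) (jB : B →* P) (hcomm : jA.comp f = jB.comp g)
    (huniv : ∀ (Q : Type) [Group Q] (kA : A →* Q) (kB : B →* Q),
      kA.comp f = kB.comp g → ∃! h : P →* Q, h.comp jA = kA ∧ h.comp jB = kB)
    (hA : ∀ a (x : Ω), jA a • x = x → a = 1) (hB : ∀ b (x : Ω), jB b • x = x → b = 1) :
    Nonempty (IsFreeGroupoid (ActionCategory P Ω)) := by
  classical
  have hfg : ∀ k, jA (f k) = jB (g k) := DFunLike.congr_fun hcomm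
  obtain ⟨c, hc, hc'⟩ := exists_orbit_section (jA.comp f) Ω
  choose kC hkC using hc'
  replace hc : ∀ k x, c (jA (f k) • x) = c x := hc
  replace hkC : ∀ x, jA (f (kC x)) • c x = x := hkC
  have hcc : ∀ x, c (c x) = c x := fun x => by conv_rhs => rw [← hkC x, hc]
  have base : ∀ {K : Type} [Group K] (j : K →* P) (i : C →* K) (_ : ∀ k, jA (f k) = j (i k)),
      ∃ r : Ω → Ω, (∀ k x, r (j k • x) = r x) ∧ (∀ x, ∃ k, j k • r x = x) ∧
        (∀ x, c (r x) = r x) ∧ ∀ x, r (c x) = r x := by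
    intro K _ j i hi
    obtain ⟨r, hr, hr'⟩ := exists_orbit_section j Ω
    refine ⟨fun x => c (r x), fun k x => congrArg c (hr k x), fun x => ?_, fun x => hcc _, fun x => ?_⟩
    · obtain ⟨k, hk⟩ := hr' x
      refine ⟨k * i (kC (r x)), ?_⟩
      rw [map_mul, mul_smul, ← hi, hkC, hk]
    · conv_rhs => rw [← hkC x, hi]
      exact congrArg c (hr _ _).symm
  obtain ⟨a, ha, ha', hca, hac⟩ := base jA f fun _ => rfl
  choose kA hkA using ha'
  obtain ⟨b, hb, hb', hcb, hbc⟩ := base jB g hfg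
  choose kB hkB using hb'
  have haa : ∀ x, a (a x) = a x := fun x => by conv_rhs => rw [← hkA x, ha]
  have hbb : ∀ x, b (b x) = b x := fun x => by conv_rhs => rw [← hkB x, hb]
  refine ⟨IsFreeGroupoid.ofUniqueCocycle
    (ι := {x // x ≠ c x} ⊕ {x // x = c x ∧ x ≠ a x} ⊕ {x // x = c x ∧ x ≠ b x})
    (Sum.elim (fun x => c x) (Sum.elim (fun x => a x) fun x => b x))
    (Sum.elim (fun x => x) (Sum.elim (fun x => x) fun x => x))
    (Sum.elim (fun x => jA (f (kC x))) (Sum.elim (fun x => jA (kA x)) fun x => jB (kB x)))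
    ?_ ?_⟩
  · rintro (x | x | x)
    exacts [hkC _, hkA _, hkB _]
  intro X _ l
  let w : Ω → X := fun x => if h : x ≠ c x then l (.inl ⟨x, h⟩) else 1
  let vA : Ω → X := fun x => if h : x = c x ∧ x ≠ a x then l (.inr (.inl ⟨x, h⟩)) else 1
  let vB : Ω → X := fun x => if h : x = c x ∧ x ≠ b x then l (.inr (.inr ⟨x, h⟩)) else 1
  have hw : ∀ x, c x = x → w x = 1 := fun x h => dif_neg fun h' => h' h.symm
  have hvA : ∀ x, a x = x → vA x = 1 := fun x h => dif_neg fun h' => h'.2 h.symm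
  have hvB : ∀ x, b x = x → vB x = 1 := fun x h => dif_neg fun h' => h'.2 h.symm
  let uA : Ω → X := fun x => w x * vA (c x)
  let uB : Ω → X := fun x => w x * vB (c x)
  obtain ⟨φ, ⟨hφA, hφB⟩, -⟩ := huniv _ (coboundary jA uA) (coboundary jB uB) (by
    ext k y
    · change uA y * (uA ((jA (f k))⁻¹ • y))⁻¹ = uB y * (uB ((jB (g k))⁻¹ • y))⁻¹
      have : c ((jA (f k))⁻¹ • y) = c y := by rw [← hc k, smul_inv_smul]
      rw [← hfg]
      simp only [uA, uB, this]
      group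
    · exact hfg k)
  have extP : ∀ (Q : Type) [Group Q] (h₁ h₂ : P →* Q), h₁.comp jA = h₂.comp jA →
      h₁.comp jB = h₂.comp jB → h₁ = h₂ := by
    intro Q _ h₁ h₂ e₁ e₂
    exact (huniv Q (h₂.comp jA) (h₂.comp jB) (by
      rw [MonoidHom.comp_assoc, hcomm, MonoidHom.comp_assoc])).unique ⟨e₁, e₂⟩ ⟨rfl, rfl⟩
  have hφA' : ∀ k y, (φ (jA k)).left y = uA y * (uA ((jA k)⁻¹ • y))⁻¹ := fun k y => by
    rw [← MonoidHom.comp_apply, hφA]; rfl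
  have hφB' : ∀ k y, (φ (jB k)).left y = uB y * (uB ((jB k)⁻¹ • y))⁻¹ := fun k y => by
    rw [← MonoidHom.comp_apply, hφB]; rfl
  refine ⟨φ, ⟨?_, ?_⟩, ?_⟩
  · have : SemidirectProduct.rightHom.comp φ = MonoidHom.id P := by
      apply extP
      · rw [MonoidHom.comp_assoc, hφA]; rfl
      · rw [MonoidHom.comp_assoc, hφB]; rfl
    exact DFunLike.congr_fun this
  · rintro (⟨x, hx⟩ | ⟨x, hx⟩ | ⟨x, hx⟩)
    · change (φ (jA (f (kC x)))).left x = _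
      rw [hφA', inv_smul_eq_iff.2 (hkC x).symm]
      simp only [uA, hcc, hw (c x) (hcc x)]
      simp [w, hx]
    · change (φ (jA (kA x))).left x = _
      rw [hφA', inv_smul_eq_iff.2 (hkA x).symm]
      simp only [uA, hca, hw (a x) (hca x), hvA (a x) (haa x), ← hx.1, hw x hx.1.symm]
      simp [vA, dif_pos hx]
    · change (φ (jB (kB x))).left x = _
      rw [hφB', inv_smul_eq_iff.2 (hkB x).symm]
      simp only [uB, hcb, hw (b x) (hcb x), hvB (b x) (hbb x), ← hx.1, hw x hx.1.symm]
      simp [vB, dif_pos hx]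
  · rintro ψ ⟨hψ, hl⟩
    have along : ∀ {K : Type} [Group K] (j : K →* P) (i : C →* K)
        (_ : ∀ k, jA (f k) = j (i k)) (_ : ∀ k (x : Ω), j k • x = x → k = 1)
        (r : Ω → Ω) (κ : Ω → K) (_ : ∀ x, j (κ x) • r x = x) (_ : ∀ x, r (c x) = r x)
        (v : Ω → X) (_ : ∀ x, r x = x → v x = 1)
        (_ : ∀ x, x = c x → x ≠ r x → (ψ (j (κ x))).left x = v x) (x : Ω),
        (ψ (j (κ x))).left x = w x * v (c x) := by
      intro K _ j i hi hj r κ hκ hrc v hv hv' x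
      have hvc : (ψ (j (κ (c x)))).left (c x) = v (c x) := by
        by_cases h : c x = r (c x)
        · rw [hv _ h.symm, hj (κ (c x)) (c x) (by simpa only [← h] using hκ (c x)), map_one,
            cocycle_one]
        · exact hv' _ (hcc x).symm h
      by_cases h : x = c x
      · rw [hw x h.symm, one_mul, ← hvc, ← h]
      · have hk : κ x = i (kC x) * κ (c x) := by
          rw [← inv_mul_eq_one]
          apply hj _ (r x)
          rw [map_mul, map_inv, map_mul, ← hi, mul_smul, mul_smul, inv_smul_eq_iff, hκ]
          conv_lhs => rw [← hrc x, hκ, hkC]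
        rw [hk, map_mul j, cocycle_mul hψ, ← hi, inv_smul_eq_iff.2 (hkC x).symm, hvc]
        congr 1
        rw [show w x = _ from dif_pos h]
        exact hl (.inl ⟨x, h⟩)
    apply extP
    · rw [hφA]
      refine cocycle_eq_coboundary jA hA hψ ha hkA
        (along jA f (fun _ => rfl) hA a kA hkA hac vA hvA fun x h₁ h₂ => ?_)
      rw [show vA x = _ from dif_pos ⟨h₁, h₂⟩]
      exact hl (.inr (.inl ⟨x, h₁, h₂⟩))
    · rw [hφB]
      refine cocycle_eq_coboundary jB hB hψ hb hkB
        (along jB g hfg hB b kB hkB hbc vB hvB fun x h₁ h₂ => ?_)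
      rw [show vB x = _ from dif_pos ⟨h₁, h₂⟩]
      exact hl (.inr (.inr ⟨x, h₁, h₂⟩))

/-- A group decomposes, as a set with the left multiplication action of an embedded group, into
a product with a trivial action. -/
theorem exists_equiv_prod_of_injective {A C : Type} [Group A] [Group C] (f : C →* A)
    (hf : Function.Injective f) :
    ∃ (T : Set A) (e : A ≃ C × T), ∀ k a, e (f k * a) = (k * (e a).1, (e a).2) := by
  obtain ⟨T, hT, -⟩ := f.range.exists_isComplement_right 1
  refine ⟨T, hT.equiv.trans ((MonoidHom.ofInjective hf).symm.toEquiv.prodCongr (.refl _)),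
    fun k a => ?_⟩
  have := hT.equiv_mul_left (MonoidHom.ofInjective hf k) a
  rw [MonoidHom.ofInjective_apply] at this
  refine Prod.ext ?_ ?_
  · change (MonoidHom.ofInjective hf).symm (hT.equiv (f k * a)).1 =
      k * (MonoidHom.ofInjective hf).symm (hT.equiv a).1
    rw [this, map_mul, MulEquiv.symm_apply_apply]
  · exact congrArg (fun p => p.2) this

/-- Two finite groups with a common subgroup embed compatibly as semiregular permutation groups
of a finite nonempty set. -/
theorem exists_semiregular_perm_of_amalgam {A B C : Type} [Group A] [Group B] [Group C]
    [Finite A] [Finite B] (f : C →* A) (g : C →* B)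
    (hf : Function.Injective f) (hg : Function.Injective g) :
    ∃ (Ω : Type) (kA : A →* Equiv.Perm Ω) (kB : B →* Equiv.Perm Ω), Finite Ω ∧ Nonempty Ω ∧
      kA.comp f = kB.comp g ∧ (∀ a x, kA a x = x → a = 1) ∧ ∀ b x, kB b x = x → b = 1 := by
  obtain ⟨S, eA, hA⟩ := exists_equiv_prod_of_injective f hf
  obtain ⟨T, eB, hB⟩ := exists_equiv_prod_of_injective g hg
  let e : B × S ≃ A × T :=
    { toFun := fun p => (eA.symm ((eB p.1).1, p.2), (eB p.1).2)
      invFun := fun p => (eB.symm ((eA p.1).1, p.2), (eA p.1).2)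
      left_inv := fun p => by simp
      right_inv := fun p => by simp }
  have he : ∀ k b s, e (g k * b, s) = (f k * (e (b, s)).1, (e (b, s)).2) := by
    intro k b s
    refine Prod.ext ?_ ?_
    · change eA.symm ((eB (g k * b)).1, s) = f k * eA.symm ((eB b).1, s)
      rw [Equiv.symm_apply_eq, hA, hB]
      simp
    · change (eB (g k * b)).2 = (eB b).2
      rw [hB]
  let mA : A →* Equiv.Perm (A × T) :=
    { toFun := fun a => (Equiv.mulLeft a).prodCongr (.refl T)
      map_one' := by ext <;> simp
      map_mul' := fun a a' => by ext <;> simp [mul_assoc] }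
  let mB : B →* Equiv.Perm (B × S) :=
    { toFun := fun b => (Equiv.mulLeft b).prodCongr (.refl S)
      map_one' := by ext <;> simp
      map_mul' := fun b b' => by ext <;> simp [mul_assoc] }
  have : Nonempty T := ⟨(eB 1).2⟩
  refine ⟨A × T, mA, e.permCongrHom.toMonoidHom.comp mB, inferInstance, inferInstance,
    ?_, ?_, ?_⟩
  · refine MonoidHom.ext fun k => Equiv.ext fun p => ?_
    obtain ⟨⟨b, s⟩, rfl⟩ := e.surjective p
    change (f k * (e (b, s)).1, (e (b, s)).2) = e (mB (g k) (e.symm (e (b, s))))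
    rw [Equiv.symm_apply_apply]
    exact (he k b s).symm
  · intro a p h
    exact mul_eq_right.1 (congrArg Prod.fst h : a * p.1 = p.1)
  · intro b p h
    have h' : mB b (e.symm p) = e.symm p := e.injective (h.trans (e.apply_symm_apply p).symm)
    exact mul_eq_right.1 (congrArg Prod.fst h' : b * (e.symm p).1 = (e.symm p).1)

theorem amalgam_of_finite_virtuallyFree
    {A B C : Type} [Group A] [Group B] [Group C] [Finite A] [Finite B]
    (f : C →* A) (g : C →* B)
    (hf : Function.Injective f) (hg : Function.Injective g)
    (P : Type) [Group P] (jA : A →* P) (jB : B →* P)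
    (hcomm : jA.comp f = jB.comp g)
    (huniv : ∀ (Q : Type) [Group Q] (kA : A →* Q) (kB : B →* Q),
      kA.comp f = kB.comp g →
        ∃! h : P →* Q, h.comp jA = kA ∧ h.comp jB = kB) :
    ∃ H : Subgroup P, H.FiniteIndex ∧ IsFreeGroup H := by
  obtain ⟨Ω, kA, kB, _, ⟨x⟩, hk, hA, hB⟩ := exists_semiregular_perm_of_amalgam f g hf hg
  obtain ⟨ρ, ⟨rfl, rfl⟩, -⟩ := huniv _ kA kB hk
  let : MulAction P Ω := MulAction.compHom Ω ρ
  let x' : MulAction.orbit P x := ⟨x, MulAction.mem_orbit_self x⟩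
  obtain ⟨hfree⟩ := amalgam_nonempty_isFreeGroupoid (Ω := MulAction.orbit P x) f g jA jB hcomm huniv
    (fun a y h => hA a y (congrArg Subtype.val h)) (fun b y h => hB b y (congrArg Subtype.val h))
  refine ⟨MulAction.stabilizer P x', ⟨?_⟩, ?_⟩
  · rw [MulAction.index_stabilizer]
    exact (Set.ncard_pos (Set.toFinite _)).2 ⟨_, MulAction.mem_orbit_self x'⟩ |>.ne'
  · exact isFreeGroup_stabilizer x' hfree
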